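/- Let r and s be bounded transfinite sequences of reals of the same nonzero length, and let r + s denote their pointwise sum. Then M̄(r + s) ≤ M̄(r) + M̄(s). -/

import Mathlib

open Ordinal

/-- The number `n` of full blocks in the standard decomposition `o = ω^σ·n + ρ`,
where `ω^σ = ω ^ log ω o` is the largest indecomposable ordinal `≤ o`. -/
noncomputable def stdBlocks (o : Ordinal.{0}) : ℕ :=
  Cardinal.toNat (o / omega0 ^ log omega0 o).card

/-- The upper mean `M̄` of a transfinite sequence of reals.  A sequence of length `o`
is encoded as a total function `f : Ordinal → ℝ`; only the values of `f` at ordinals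
`< o` are ever used.  It is defined by transfinite recursion on `o`:
(1) for `o = 1` it is `f 0`;
(2) for `o` indecomposable with `o > 1` (i.e. `o = ω^σ` with `σ > 0`) it is
    `limsup_{ξ → o} M̄(f|_ξ) = inf_{1 ≤ ζ < o} sup_{ζ ≤ ξ < o} M̄(f|_ξ)`;
(3) for decomposable `o`, writing `o = ω^σ·n + ρ` with `ρ < ω^σ`, it is the average
    `(1/n) (M̄(s₀) + ⋯ + M̄(s_{n-1}))` of the upper means of the `n` consecutive
    blocks of `f` of length `ω^σ` (the remainder of length `ρ` is discarded). -/
noncomputable def upperMean (o : Ordinal.{0}) (f : Ordinal.{0} → ℝ) : ℝ :=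
  if o = 1 then f 0
  else if h1 : 1 < o ∧ o = omega0 ^ log omega0 o then
    ⨅ ζ : Set.Ico (1 : Ordinal.{0}) o, ⨆ ξ : Set.Ico ζ.1 o, upperMean ξ.1 f
  else if h2 : 1 < o then
    ((stdBlocks o : ℝ))⁻¹ *
      ∑ i ∈ Finset.range (stdBlocks o),
        upperMean (omega0 ^ log omega0 o)
          (fun ξ => f (omega0 ^ log omega0 o * (i : Ordinal) + ξ))
  else 0
termination_by o
decreasing_by
  · exact ξ.2.2
  · exact lt_of_le_of_ne (opow_log_le_self _ (zero_lt_one.trans h2).ne')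
      fun h => h1 ⟨h2, h.symm⟩

/-- A transfinite sequence of reals of length `o` is bounded if its range
(on indices `< o`) is bounded in `ℝ`. -/
def SeqBounded (o : Ordinal.{0}) (f : Ordinal.{0} → ℝ) : Prop :=
  ∃ C : ℝ, ∀ ξ < o, |f ξ| ≤ C

/-- The concatenation `r ⊕ s` of a sequence `r` of length `a` with a sequence `s`:
its first `a` entries are those of `r`, and its entry at `a + ξ'` is `s ξ'`. -/
noncomputable def concatSeq (a : Ordinal.{0}) (r s : Ordinal.{0} → ℝ) :
    Ordinal.{0} → ℝ :=
  fun ξ => if ξ < a then r ξ else s (ξ - a)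

/-- An ordinal is indecomposable if it is nonzero and not the sum of two strictly
smaller ordinals. -/
def IsIndecomposable (o : Ordinal.{0}) : Prop :=
  o ≠ 0 ∧ ∀ b < o, ∀ c < o, b + c ≠ o

/-- The concatenation `s₀ ⊕ s₁ ⊕ ⋯ ⊕ s_{n-1}` of `n` sequences, each of length `β`;
the result has length `β * n`. -/
noncomputable def concatN (β : Ordinal.{0}) :
    (n : ℕ) → (Fin n → Ordinal.{0} → ℝ) → Ordinal.{0} → ℝ
  | 0, _ => fun _ => 0
  | n + 1, s => concatSeq (β * n) (concatN β n (fun i => s i.castSucc)) (s (Fin.last n))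

/-- `s / β`: given a sequence `s` whose length is `β * α`, the sequence of length `α`
whose `ι`-th entry is the upper mean of the `ι`-th consecutive block of `s` of
length `β`. -/
noncomputable def seqDiv (s : Ordinal.{0} → ℝ) (β : Ordinal.{0}) : Ordinal.{0} → ℝ :=
  fun ι => upperMean β (fun ξ => s (β * ι + ξ))

/-- The lower mean `𝕄̲(s) = -M̄(-s)`. -/
noncomputable def lowerMean (o : Ordinal.{0}) (s : Ordinal.{0} → ℝ) : ℝ :=
  - upperMean o (fun ξ => - s ξ)

/-- A sequence `s` of length `o` has mean `c` when its upper and lower means both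
equal `c`. -/
def HasMean (o : Ordinal.{0}) (s : Ordinal.{0} → ℝ) (c : ℝ) : Prop :=
  upperMean o s = c ∧ lowerMean o s = c

theorem upperMean_one (f : Ordinal.{0} → ℝ) : upperMean 1 f = f 0 := by
  rw [upperMean, if_pos rfl]

theorem upperMean_of_eq_opow {o : Ordinal.{0}} (h : 1 < o) (ho : o = omega0 ^ log omega0 o)
    (f : Ordinal.{0} → ℝ) :
    upperMean o f = ⨅ ζ : Set.Ico (1 : Ordinal.{0}) o, ⨆ ξ : Set.Ico ζ.1 o, upperMean ξ.1 f := by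
  rw [upperMean, if_neg h.ne', dif_pos ⟨h, ho⟩]

theorem upperMean_of_ne_opow {o : Ordinal.{0}} (h : 1 < o) (ho : o ≠ omega0 ^ log omega0 o)
    (f : Ordinal.{0} → ℝ) :
    upperMean o f = ((stdBlocks o : ℝ))⁻¹ * ∑ i ∈ Finset.range (stdBlocks o),
      upperMean (omega0 ^ log omega0 o)
        (fun ξ => f (omega0 ^ log omega0 o * (i : Ordinal) + ξ)) := by
  rw [upperMean, if_neg h.ne', dif_neg fun h' => ho h'.2, dif_pos h]

theorem opow_log_mul_add_lt {o : Ordinal.{0}} {i : ℕ} (hi : i < stdBlocks o) {ξ : Ordinal.{0}}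
    (hξ : ξ < omega0 ^ log omega0 o) : omega0 ^ log omega0 o * (i : Ordinal) + ξ < o := by
  have hcard : ((i + 1 : ℕ) : Cardinal) ≤ (o / omega0 ^ log omega0 o).card :=
    (Nat.cast_le.2 (Nat.succ_le_of_lt hi)).trans (Cardinal.natCast_toNat_le _)
  rw [Ordinal.nat_le_card] at hcard
  calc omega0 ^ log omega0 o * (i : Ordinal) + ξ
      < omega0 ^ log omega0 o * (i : Ordinal) + omega0 ^ log omega0 o := by gcongr
    _ = omega0 ^ log omega0 o * ((i + 1 : ℕ) : Ordinal) := by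
        rw [Nat.cast_succ, mul_add_one]
    _ ≤ omega0 ^ log omega0 o * (o / omega0 ^ log omega0 o) := by gcongr
    _ ≤ o := Ordinal.mul_div_le _ _

/-- A property of nonzero lengths holds if it holds for length `1`, passes to indecomposable
lengths from all smaller ones, and passes from `ω ^ σ` to the lengths with leading term `ω ^ σ`. -/
theorem blockInduction {p : (o : Ordinal.{0}) → o ≠ 0 → Prop} (one : p 1 one_ne_zero)
    (opow : ∀ (o : Ordinal.{0}) (h : 1 < o), o = omega0 ^ log omega0 o →
      (∀ (ξ : Ordinal.{0}) (hξ : 1 ≤ ξ), ξ < o → p ξ (Order.one_le_iff_ne_zero.1 hξ)) →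
        p o (zero_lt_one.trans h).ne')
    (block : ∀ (o : Ordinal.{0}) (h : 1 < o), o ≠ omega0 ^ log omega0 o →
      p (omega0 ^ log omega0 o) (opow_pos _ omega0_pos).ne' → p o (zero_lt_one.trans h).ne')
    {o : Ordinal.{0}} (ho : o ≠ 0) : p o ho := by
  induction o using WellFoundedLT.induction with
  | ind o ih =>
    rcases (Order.one_le_iff_ne_zero.2 ho).eq_or_lt with rfl | h1
    · exact one
    by_cases h : o = omega0 ^ log omega0 o
    · exact opow o h1 h fun ξ hξ hξo => ih ξ hξo (Order.one_le_iff_ne_zero.1 hξ)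
    · exact block o h1 h (ih _ (lt_of_le_of_ne (opow_log_le_self _ ho) (Ne.symm h)) _)

theorem abs_upperMean_le {o : Ordinal.{0}} (ho : o ≠ 0) :
    ∀ {f : Ordinal.{0} → ℝ} {C : ℝ}, (∀ ξ < o, |f ξ| ≤ C) → |upperMean o f| ≤ C := by
  induction ho using blockInduction with
  | one =>
    intro f C hf
    rw [upperMean_one]
    exact hf 0 zero_lt_one
  | opow o h1 h ih =>
    intro f C hf
    have hb (ξ : Ordinal.{0}) (hξ : 1 ≤ ξ) (hξo : ξ < o) : |upperMean ξ f| ≤ C :=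
      ih ξ hξ hξo fun η hη => hf η (hη.trans hξo)
    have hne : Nonempty (Set.Ico (1 : Ordinal.{0}) o) := ⟨⟨1, le_rfl, h1⟩⟩
    have hle (ζ : Set.Ico (1 : Ordinal.{0}) o) :
        (⨆ ξ : Set.Ico ζ.1 o, upperMean ξ.1 f) ≤ C :=
      have : Nonempty (Set.Ico ζ.1 o) := ⟨⟨ζ.1, le_rfl, ζ.2.2⟩⟩
      ciSup_le fun ξ => (abs_le.1 (hb ξ.1 (ζ.2.1.trans ξ.2.1) ξ.2.2)).2
    have hge (ζ : Set.Ico (1 : Ordinal.{0}) o) :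
        -C ≤ ⨆ ξ : Set.Ico ζ.1 o, upperMean ξ.1 f := by
      refine le_ciSup_of_le ⟨C, ?_⟩ ⟨ζ.1, le_rfl, ζ.2.2⟩ (abs_le.1 (hb ζ.1 ζ.2.1 ζ.2.2)).1
      rintro _ ⟨ξ, rfl⟩
      exact (abs_le.1 (hb ξ.1 (ζ.2.1.trans ξ.2.1) ξ.2.2)).2
    rw [upperMean_of_eq_opow h1 h, abs_le]
    refine ⟨le_ciInf hge, ciInf_le_of_le ⟨-C, ?_⟩ ⟨1, le_rfl, h1⟩ (hle _)⟩
    rintro _ ⟨ζ, rfl⟩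
    exact hge ζ
  | block o h1 h ih =>
    intro f C hf
    have hC : 0 ≤ C := (abs_nonneg _).trans (hf 0 (zero_lt_one.trans h1))
    rw [upperMean_of_ne_opow h1 h, abs_mul, abs_inv, Nat.abs_cast]
    refine inv_mul_le_of_le_mul₀ (Nat.cast_nonneg _) hC ?_
    refine (Finset.abs_sum_le_sum_abs _ _).trans ?_
    refine (Finset.sum_le_card_nsmul _ _ C fun i hi => ?_).trans_eq ?_
    · exact ih fun ξ hξ => hf _ (opow_log_mul_add_lt (Finset.mem_range.1 hi) hξ)
    · rw [Finset.card_range, _root_.nsmul_eq_mul]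

theorem bddAbove_range_upperMean {o ζ : Ordinal.{0}} (hζ : 1 ≤ ζ) {f : Ordinal.{0} → ℝ}
    (hf : SeqBounded o f) : BddAbove (Set.range fun ξ : Set.Ico ζ o => upperMean ξ.1 f) := by
  obtain ⟨C, hC⟩ := hf
  refine ⟨C, ?_⟩
  rintro _ ⟨ξ, rfl⟩
  exact (le_abs_self _).trans (abs_upperMean_le (Order.one_le_iff_ne_zero.1 (hζ.trans ξ.2.1))
    fun η hη => hC η (hη.trans ξ.2.2))

theorem bddBelow_range_iSup_upperMean {o : Ordinal.{0}} {f : Ordinal.{0} → ℝ}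
    (hf : SeqBounded o f) : BddBelow (Set.range fun ζ : Set.Ico (1 : Ordinal.{0}) o =>
      ⨆ ξ : Set.Ico ζ.1 o, upperMean ξ.1 f) := by
  obtain ⟨C, hC⟩ := id hf
  refine ⟨-C, ?_⟩
  rintro _ ⟨ζ, rfl⟩
  exact le_ciSup_of_le (bddAbove_range_upperMean ζ.2.1 hf) ⟨ζ.1, le_rfl, ζ.2.2⟩
    (abs_le.1 (abs_upperMean_le (Order.one_le_iff_ne_zero.1 ζ.2.1)
      fun η hη => hC η (hη.trans ζ.2.2))).1

theorem SeqBounded.mono {o o' : Ordinal.{0}} {f : Ordinal.{0} → ℝ} (hf : SeqBounded o f)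
    (h : o' ≤ o) : SeqBounded o' f :=
  hf.imp fun _ hC ξ hξ => hC ξ (hξ.trans_le h)

theorem SeqBounded.add {o : Ordinal.{0}} {r s : Ordinal.{0} → ℝ} (hr : SeqBounded o r)
    (hs : SeqBounded o s) : SeqBounded o (fun ξ => r ξ + s ξ) := by
  obtain ⟨C, hC⟩ := hr
  obtain ⟨D, hD⟩ := hs
  exact ⟨C + D, fun ξ hξ => (abs_add_le _ _).trans (add_le_add (hC ξ hξ) (hD ξ hξ))⟩

theorem SeqBounded.block {o : Ordinal.{0}} {f : Ordinal.{0} → ℝ} (hf : SeqBounded o f) {i : ℕ}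
    (hi : i < stdBlocks o) : SeqBounded (omega0 ^ log omega0 o)
      (fun ξ => f (omega0 ^ log omega0 o * (i : Ordinal) + ξ)) :=
  hf.imp fun _ hC _ hξ => hC _ (opow_log_mul_add_lt hi hξ)

/-- subadditivity of the upper mean.  For bounded sequences `r`, `s`
of the same nonzero length `o`: `M̄(r + s) ≤ M̄(r) + M̄(s)`. -/
theorem upperMean_add_le (o : Ordinal.{0}) (ho : o ≠ 0) (r s : Ordinal.{0} → ℝ)
    (hr : SeqBounded o r) (hs : SeqBounded o s) :
    upperMean o (fun ξ => r ξ + s ξ) ≤ upperMean o r + upperMean o s := by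
  induction ho using blockInduction generalizing r s with
  | one => simp only [upperMean_one, le_refl]
  | opow o h1 h ih =>
    have hne : Nonempty (Set.Ico (1 : Ordinal.{0}) o) := ⟨⟨1, le_rfl, h1⟩⟩
    simp only [upperMean_of_eq_opow h1 h]
    refine le_ciInf_add_ciInf fun ζ₁ ζ₂ => ?_
    let ζ := max ζ₁ ζ₂
    have : Nonempty (Set.Ico ζ.1 o) := ⟨⟨ζ.1, le_rfl, ζ.2.2⟩⟩
    have h₁ : ζ₁.1 ≤ ζ.1 := le_max_left ζ₁ ζ₂
    have h₂ : ζ₂.1 ≤ ζ.1 := le_max_right ζ₁ ζ₂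
    refine ciInf_le_of_le (bddBelow_range_iSup_upperMean (hr.add hs)) ζ (ciSup_le fun ξ => ?_)
    refine (ih ξ.1 (ζ.2.1.trans ξ.2.1) ξ.2.2 r s
      (hr.mono ξ.2.2.le) (hs.mono ξ.2.2.le)).trans (add_le_add ?_ ?_)
    · exact le_ciSup (bddAbove_range_upperMean ζ₁.2.1 hr) ⟨ξ.1, h₁.trans ξ.2.1, ξ.2.2⟩
    · exact le_ciSup (bddAbove_range_upperMean ζ₂.2.1 hs) ⟨ξ.1, h₂.trans ξ.2.1, ξ.2.2⟩
  | block o h1 h ih =>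
    simp only [upperMean_of_ne_opow h1 h]
    rw [← mul_add, ← Finset.sum_add_distrib]
    gcongr with i hi
    rw [Finset.mem_range] at hi
    exact ih _ _ (hr.block hi) (hs.block hi)
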